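/- (Continuity for trees) Let L be a complete leaf set over a finite alphabet Z with branching set B, let P_Y be a probability distribution on L with node probabilities Q, branching distributions P_{Y_t}, and P_B(t) := Q(t)/E[ℓ(Y)], and let P_Z be a probability distribution on Z. Let g be a real-valued function on the set of probability distributions on Z such that |g(P) − g(P')| ≤ g_max for all probability distributions P, P' on Z. Suppose ε > 0, δ ≥ 0, and θ ≥ 0 are such that: (i) for every probability distribution P on Z with ‖P − P_Z‖₁ ≤ ε one has |g(P) − g(P_Z)| ≤ δ; and (ii) Σ_{t ∈ B} P_B(t) ‖P_{Y_t} − P_Z‖₁ ≤ θ. Then |Σ_{t ∈ B} P_B(t) g(P_{Y_t}) − g(P_Z)| ≤ δ + (θ/ε) g_max, where terms with Q(t) = 0 are taken to be 0. -/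

import Mathlib

open Finset

noncomputable section

/-- A finite set of nonempty strings over `Z` is a *complete leaf set* if it is
prefix-free and every sufficiently long string over `Z` has exactly one prefix in it
(equivalently, it is the leaf set of a finite rooted tree in which every branching
node has exactly `|Z|` children, one per letter). -/
def IsCompleteLeafSet {Z : Type*} (L : Finset (List Z)) : Prop :=
  (∀ t ∈ L, t ≠ []) ∧
  (∀ s ∈ L, ∀ t ∈ L, s <+: t → s = t) ∧
  (∃ N : ℕ, ∀ s : List Z, N ≤ s.length → ∃! t, t ∈ L ∧ t <+: s)

/-- The branching set: all proper prefixes of leaves, including the root `[]`. -/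
def branchSet {Z : Type*} [DecidableEq Z] (L : Finset (List Z)) : Finset (List Z) :=
  L.biUnion fun t => (Finset.range t.length).image fun i => t.take i

/-- Node probability `Q(t)`: total probability of the leaves having `t` as a prefix. -/
def nodeProb {Z : Type*} [DecidableEq Z] (L : Finset (List Z)) (P : List Z → ℝ)
    (t : List Z) : ℝ :=
  ∑ s ∈ L.filter (fun s => t <+: s), P s

/-- Branching distribution `P_{Y_t}(z) = Q(tz)/Q(t)` (junk value `0` when `Q(t) = 0`,
so that terms with `Q(t) = 0` vanish). -/
def branchDist {Z : Type*} [DecidableEq Z] (L : Finset (List Z)) (P : List Z → ℝ)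
    (t : List Z) (z : Z) : ℝ :=
  nodeProb L P (t ++ [z]) / nodeProb L P t

/-- Expected leaf depth `E[ℓ(Y)]`. -/
def expLen {Z : Type*} (L : Finset (List Z)) (P : List Z → ℝ) : ℝ :=
  ∑ t ∈ L, P t * t.length

/-- Shannon entropy in bits of `P` on the finite set `S` (terms with `P x = 0` vanish). -/
def ent {α : Type*} (S : Finset α) (P : α → ℝ) : ℝ :=
  ∑ x ∈ S, -(P x * Real.logb 2 (P x))

/-- Informational divergence in bits of `P` from `P'` on `S` (terms with `P x = 0` vanish). -/
def kl {α : Type*} (S : Finset α) (P P' : α → ℝ) : ℝ :=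
  ∑ x ∈ S, P x * Real.logb 2 (P x / P' x)

/-- The leaf distribution induced by a memoryless source: `P_Z^L(t) = ∏ i, P_Z(t_i)`. -/
def inducedProb {Z : Type*} (P : Z → ℝ) (t : List Z) : ℝ :=
  (t.map P).prod

/-- `L¹` (total variation) distance between two distributions on a finite alphabet. -/
def l1dist {Z : Type*} [Fintype Z] (P P' : Z → ℝ) : ℝ :=
  ∑ z, |P z - P' z|

/-- A probability distribution on the finite alphabet `Z`. -/
def IsDist {Z : Type*} [Fintype Z] (P : Z → ℝ) : Prop :=
  (∀ z, 0 ≤ P z) ∧ ∑ z, P z = 1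

theorem not_leaf_of_mem_branchSet {Z : Type*} [DecidableEq Z] (L : Finset (List Z))
    (hL : IsCompleteLeafSet L) (t : List Z) (ht : t ∈ branchSet L) : t ∉ L := by
  intro htL
  simp only [branchSet, mem_biUnion, mem_image, mem_range] at ht
  obtain ⟨s, hs, i, hi, rfl⟩ := ht
  have h := hL.2.1 _ htL _ hs (List.take_prefix i s)
  have h2 := congrArg List.length h
  rw [List.length_take] at h2
  omega

theorem branchSet_filter {Z : Type*} [DecidableEq Z] (L : Finset (List Z))
    (hL : IsCompleteLeafSet L) (s : List Z) (hs : s ∈ L) :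
    ((branchSet L).filter (fun t => t <+: s)).card = s.length := by
  have h : (branchSet L).filter (fun t => t <+: s)
      = (Finset.range s.length).image fun i => s.take i := by
    ext t
    simp only [mem_filter, mem_image, mem_range]
    constructor
    · rintro ⟨ht, hp⟩
      have hn := not_leaf_of_mem_branchSet L hL t ht
      refine ⟨t.length, ?_, (List.prefix_iff_eq_take.1 hp).symm⟩
      rcases lt_or_eq_of_le hp.length_le with h | h
      · exact h
      · exact absurd (hp.eq_of_length h ▸ hs) hn
    · rintro ⟨i, hi, rfl⟩
      refine ⟨?_, List.take_prefix i s⟩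
      simp only [branchSet, mem_biUnion, mem_image, mem_range]
      exact ⟨s, hs, i, hi, rfl⟩
  rw [h, Finset.card_image_of_injOn, Finset.card_range]
  intro i hi j hj hij
  simp only [coe_range, Set.mem_Iio] at hi hj
  have h2 := congrArg List.length hij
  simp only [List.length_take] at h2
  omega

theorem sum_nodeProb {Z : Type*} [DecidableEq Z] (L : Finset (List Z))
    (hL : IsCompleteLeafSet L) (P : List Z → ℝ) :
    ∑ t ∈ branchSet L, nodeProb L P t = expLen L P := by
  unfold nodeProb expLen
  simp only [Finset.sum_filter]
  rw [Finset.sum_comm]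
  refine Finset.sum_congr rfl fun s hs => ?_
  rw [← Finset.sum_filter, Finset.sum_const, branchSet_filter L hL s hs, nsmul_eq_mul, mul_comm]

theorem sum_children {Z : Type*} [Fintype Z] [DecidableEq Z] (L : Finset (List Z))
    (P : List Z → ℝ) (t : List Z) (ht : t ∉ L) :
    ∑ z, nodeProb L P (t ++ [z]) = nodeProb L P t := by
  unfold nodeProb
  simp only [Finset.sum_filter]
  rw [Finset.sum_comm]
  refine Finset.sum_congr rfl fun s hs => ?_
  split_ifs with h
  · obtain ⟨r, rfl⟩ := h
    cases r with
    | nil => simp at hs; exact absurd hs ht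
    | cons a r =>
      rw [Finset.sum_eq_single a]
      · simp
      · intro b _ hb
        simp [List.prefix_append_right_inj, hb]
      · simp
  · refine Finset.sum_eq_zero fun z _ => ?_
    rw [if_neg]
    exact fun h2 => h ((List.prefix_append t [z]).trans h2)

theorem nodeProb_nonneg {Z : Type*} [DecidableEq Z] (L : Finset (List Z)) (P : List Z → ℝ)
    (hPnn : ∀ t ∈ L, 0 ≤ P t) (t : List Z) : 0 ≤ nodeProb L P t :=
  Finset.sum_nonneg fun s hs => hPnn s (Finset.mem_filter.1 hs).1

/-- **Continuity for trees.** If `g` varies by at most `g_max` over probability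
distributions on `Z`, `|g(P) − g(P_Z)| ≤ δ` whenever `‖P − P_Z‖₁ ≤ ε`, and
`Σ_{t ∈ B} P_B(t) ‖P_{Y_t} − P_Z‖₁ ≤ θ`, then
`|Σ_{t ∈ B} P_B(t) g(P_{Y_t}) − g(P_Z)| ≤ δ + (θ/ε) g_max`
(terms with `Q(t) = 0` are taken to be `0`). -/
theorem continuity_for_trees {Z : Type*} [Fintype Z] [DecidableEq Z]
    (L : Finset (List Z)) (hL : IsCompleteLeafSet L)
    (hZ : 2 ≤ Fintype.card Z)
    (P : List Z → ℝ) (hPnn : ∀ t ∈ L, 0 ≤ P t) (hPsum : ∑ t ∈ L, P t = 1)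
    (PZ : Z → ℝ) (hPZ : IsDist PZ)
    (g : (Z → ℝ) → ℝ) (gmax : ℝ)
    (hgmax : ∀ P₁ P₂ : Z → ℝ, IsDist P₁ → IsDist P₂ → |g P₁ - g P₂| ≤ gmax)
    (ε δ θ : ℝ) (hε : 0 < ε) (hδ : 0 ≤ δ) (hθ : 0 ≤ θ)
    (hcont : ∀ P₁ : Z → ℝ, IsDist P₁ → l1dist P₁ PZ ≤ ε → |g P₁ - g PZ| ≤ δ)
    (havg : ∑ t ∈ branchSet L, (nodeProb L P t / expLen L P) *
        l1dist (branchDist L P t) PZ ≤ θ) :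
    |(∑ t ∈ branchSet L, (nodeProb L P t / expLen L P) * g (branchDist L P t)) - g PZ| ≤
      δ + (θ / ε) * gmax := by
  have hE : 0 < expLen L P := by
    have : ∑ t ∈ L, P t ≤ expLen L P := by
      refine Finset.sum_le_sum fun t ht => ?_
      have h1 : (1 : ℝ) ≤ t.length := by
        exact_mod_cast List.length_pos_iff.2 (hL.1 t ht)
      nlinarith [hPnn t ht]
    linarith
  have hg0 : 0 ≤ gmax := (abs_nonneg _).trans (hgmax PZ PZ hPZ hPZ)
  have hw : ∑ t ∈ branchSet L, nodeProb L P t / expLen L P = 1 := by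
    rw [← Finset.sum_div, sum_nodeProb L hL P, div_self hE.ne']
  have key : ∀ t ∈ branchSet L,
      |(nodeProb L P t / expLen L P) * (g (branchDist L P t) - g PZ)| ≤
      (nodeProb L P t / expLen L P) * δ +
        ((nodeProb L P t / expLen L P) * l1dist (branchDist L P t) PZ) * (gmax / ε) := by
    intro t ht
    have hQ := nodeProb_nonneg L P hPnn t
    rcases hQ.eq_or_lt with h0 | hpos
    · simp [← h0]
    have hD : IsDist (branchDist L P t) := by
      refine ⟨fun z => div_nonneg (nodeProb_nonneg L P hPnn _) hQ, ?_⟩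
      unfold branchDist
      rw [← Finset.sum_div, sum_children L P t (not_leaf_of_mem_branchSet L hL t ht),
        div_self hpos.ne']
    have hd : 0 ≤ l1dist (branchDist L P t) PZ := Finset.sum_nonneg fun z _ => abs_nonneg _
    have hb : |g (branchDist L P t) - g PZ| ≤
        δ + l1dist (branchDist L P t) PZ * (gmax / ε) := by
      rcases le_or_gt (l1dist (branchDist L P t) PZ) ε with h | h
      · have := hcont _ hD h
        have : 0 ≤ l1dist (branchDist L P t) PZ * (gmax / ε) := by positivity
        linarith
      · have h1 := hgmax _ _ hD hPZ
        have h2 : ε * (gmax / ε) ≤ l1dist (branchDist L P t) PZ * (gmax / ε) :=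
          mul_le_mul_of_nonneg_right h.le (by positivity)
        rw [mul_div_cancel₀ _ hε.ne'] at h2
        linarith
    have hwt : 0 ≤ nodeProb L P t / expLen L P := by positivity
    rw [abs_mul, abs_of_nonneg hwt]
    calc _ ≤ _ := mul_le_mul_of_nonneg_left hb hwt
      _ = _ := by ring
  have heq : (∑ t ∈ branchSet L, (nodeProb L P t / expLen L P) * g (branchDist L P t)) - g PZ
      = ∑ t ∈ branchSet L,
        (nodeProb L P t / expLen L P) * (g (branchDist L P t) - g PZ) := by
    simp only [mul_sub, Finset.sum_sub_distrib]
    rw [← Finset.sum_mul, hw, one_mul]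
  rw [heq]
  refine (Finset.abs_sum_le_sum_abs _ _).trans ((Finset.sum_le_sum key).trans ?_)
  rw [Finset.sum_add_distrib, ← Finset.sum_mul, ← Finset.sum_mul, hw, one_mul]
  have := mul_le_mul_of_nonneg_right havg (show 0 ≤ gmax / ε by positivity)
  have h3 : θ * (gmax / ε) = θ / ε * gmax := by ring
  linarith
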